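/- Let G be a strongly regular graph with parameters (1911, 270, 105, 27) containing an induced quadrangle x ~ u ~ y ~ v ~ x, and let U = {u, v, w₁, w₂} be a 4-element independent set whose elements are all adjacent to x. Write c(a,b) = |N(x) ∩ N(a) ∩ N(b)|. If the sum of c(a,b) over the six unordered pairs {a,b} ⊆ U equals 154, then the multiset of the six values c(a,b) is either {24, 26, 26, 26, 26, 26} or {25, 25, 26, 26, 26, 26}, and every vertex of N(x) \ U has at most 2 neighbours in U. -/

import Mathlib

/-- `c(a,b) = |N(x) ∩ N(a) ∩ N(b)|`, the number of common neighbours of `x`, `a` and `b`. -/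
def commonNbrCount {V : Type*} [Fintype V] [DecidableEq V] (G : SimpleGraph V)
    [DecidableRel G.Adj] (x a b : V) : ℕ :=
  (G.neighborFinset x ∩ G.neighborFinset a ∩ G.neighborFinset b).card

theorem SimpleGraph.IsSRGWith.card_inter_neighborFinset_of_adj {V : Type*} [Fintype V]
    [DecidableEq V] {G : SimpleGraph V} [DecidableRel G.Adj] {n k l m : ℕ}
    (h : G.IsSRGWith n k l m) {a b : V} (hab : G.Adj a b) :
    (G.neighborFinset a ∩ G.neighborFinset b).card = l := by
  rw [← h.of_adj a b hab, ← Set.toFinset_card]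
  congr 1
  ext z
  simp [SimpleGraph.mem_commonNeighbors]

theorem SimpleGraph.IsSRGWith.card_inter_neighborFinset_of_not_adj {V : Type*} [Fintype V]
    [DecidableEq V] {G : SimpleGraph V} [DecidableRel G.Adj] {n k l m : ℕ}
    (h : G.IsSRGWith n k l m) {a b : V} (hne : a ≠ b) (hab : ¬ G.Adj a b) :
    (G.neighborFinset a ∩ G.neighborFinset b).card = m := by
  rw [← h.of_not_adj hne hab, ← Set.toFinset_card]
  congr 1
  ext z
  simp [SimpleGraph.mem_commonNeighbors]

/-- Common neighbours of `a` and `b` that are not neighbours of `x` reduce the number of common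
neighbours of `x`, `a` and `b`. -/
theorem commonNbrCount_add_card_le {V : Type*} [Fintype V] [DecidableEq V] {G : SimpleGraph V}
    [DecidableRel G.Adj] {n k l m : ℕ} (h : G.IsSRGWith n k l m) {x a b : V}
    (hne : a ≠ b) (hab : ¬ G.Adj a b) (S : Finset V)
    (hS : ∀ s ∈ S, G.Adj a s ∧ G.Adj b s ∧ ¬ G.Adj x s) :
    commonNbrCount G x a b + S.card ≤ m := by
  rw [← h.card_inter_neighborFinset_of_not_adj hne hab, commonNbrCount,
    ← Finset.card_union_of_disjoint]
  · apply Finset.card_le_card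
    intro z hz
    simp only [Finset.mem_union, Finset.mem_inter, SimpleGraph.mem_neighborFinset] at hz ⊢
    rcases hz with hz | hz
    · exact ⟨hz.1.2, hz.2⟩
    · exact ⟨(hS z hz).1, (hS z hz).2.1⟩
  · rw [Finset.disjoint_left]
    intro z hz hzS
    simp only [Finset.mem_inter, SimpleGraph.mem_neighborFinset] at hz
    exact (hS z hzS).2.2 hz.1.1

theorem sum_adj_mul_adj_eq_commonNbrCount {V : Type*} [Fintype V] [DecidableEq V]
    (G : SimpleGraph V) [DecidableRel G.Adj] (x a b : V) :
    ∑ w ∈ G.neighborFinset x, (if G.Adj w a then (1 : ℤ) else 0) * (if G.Adj w b then 1 else 0) =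
      commonNbrCount G x a b := by
  simp_rw [ite_zero_mul_ite_zero, mul_one]
  rw [Finset.sum_boole, commonNbrCount]
  congr 2
  ext z
  simp [G.adj_comm z]

theorem sum_adj_eq_card_inter {V : Type*} [Fintype V] [DecidableEq V]
    (G : SimpleGraph V) [DecidableRel G.Adj] (x a : V) :
    ∑ w ∈ G.neighborFinset x, (if G.Adj w a then (1 : ℤ) else 0) =
      (G.neighborFinset x ∩ G.neighborFinset a).card := by
  rw [Finset.sum_boole]
  congr 2
  ext z
  simp [G.adj_comm z]

/-- Let `G` be a strongly regular graph with parameters `(1911, 270, 105, 27)` with an induced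
quadrangle `x ~ u ~ y ~ v ~ x`, and let `U = {u, v, w₁, w₂}` be a 4-element independent set of
vertices all adjacent to `x`. If the sum of `c(a,b)` over the six unordered pairs of `U`
equals `154`, then the multiset of these six values is `{24, 26, 26, 26, 26, 26}` or
`{25, 25, 26, 26, 26, 26}`, and every vertex of `N(x) \ U` has at most `2` neighbours
in `U`. -/
theorem srg_1911_indep_four_sum_154 {V : Type*} [Fintype V] [DecidableEq V]
    (G : SimpleGraph V) [DecidableRel G.Adj] (h : G.IsSRGWith 1911 270 105 27)
    (x u y v : V)
    (hd : x ≠ u ∧ x ≠ y ∧ x ≠ v ∧ u ≠ y ∧ u ≠ v ∧ y ≠ v)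
    (hxu : G.Adj x u) (huy : G.Adj u y) (hyv : G.Adj y v) (hvx : G.Adj v x)
    (hxy : ¬ G.Adj x y) (huv : ¬ G.Adj u v)
    (w₁ w₂ : V) (U : Finset V) (hU : U = {u, v, w₁, w₂}) (hUcard : U.card = 4)
    (hUx : ∀ w ∈ U, G.Adj x w)
    (hUind : ∀ a ∈ U, ∀ b ∈ U, a ≠ b → ¬ G.Adj a b)
    (hsum : commonNbrCount G x u v + commonNbrCount G x u w₁ + commonNbrCount G x u w₂ +
        commonNbrCount G x v w₁ + commonNbrCount G x v w₂ + commonNbrCount G x w₁ w₂ = 154) :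
    (({commonNbrCount G x u v, commonNbrCount G x u w₁, commonNbrCount G x u w₂,
        commonNbrCount G x v w₁, commonNbrCount G x v w₂, commonNbrCount G x w₁ w₂} :
          Multiset ℕ) = ({24, 26, 26, 26, 26, 26} : Multiset ℕ) ∨
      ({commonNbrCount G x u v, commonNbrCount G x u w₁, commonNbrCount G x u w₂,
        commonNbrCount G x v w₁, commonNbrCount G x v w₂, commonNbrCount G x w₁ w₂} :
          Multiset ℕ) = ({25, 25, 26, 26, 26, 26} : Multiset ℕ)) ∧
    ∀ w ∈ G.neighborFinset x \ U, (U.filter fun z => G.Adj w z).card ≤ 2 := by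
  subst hU
  have huw₁ : u ≠ w₁ := by rintro rfl; grind
  have huw₂ : u ≠ w₂ := by rintro rfl; grind
  have hvw₁ : v ≠ w₁ := by rintro rfl; grind
  have hvw₂ : v ≠ w₂ := by rintro rfl; grind
  have hww : w₁ ≠ w₂ := by rintro rfl; grind
  have bound : ∀ a ∈ ({u, v, w₁, w₂} : Finset V), ∀ b ∈ ({u, v, w₁, w₂} : Finset V), a ≠ b →
      commonNbrCount G x a b ≤ 26 := by
    intro a ha b hb hab
    have := commonNbrCount_add_card_le h (x := x) hab (hUind a ha b hb hab) {x} (by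
      simp [(hUx a ha).symm, (hUx b hb).symm])
    rw [Finset.card_singleton] at this
    omega
  have b1 : commonNbrCount G x u v ≤ 25 := by
    have := commonNbrCount_add_card_le h (x := x) hd.2.2.2.2.1 huv {x, y} (by
      simp [hxu.symm, hvx, huy, hyv.symm, hxy])
    rw [Finset.card_pair hd.2.1] at this
    omega
  have b2 := bound u (by simp) w₁ (by simp) huw₁
  have b3 := bound u (by simp) w₂ (by simp) huw₂
  have b4 := bound v (by simp) w₁ (by simp) hvw₁
  have b5 := bound v (by simp) w₂ (by simp) hvw₂
  have b6 := bound w₁ (by simp) w₂ (by simp) hww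
  refine ⟨?_, ?_⟩
  · clear bound
    generalize commonNbrCount G x u v = c1 at *
    generalize commonNbrCount G x u w₁ = c2 at *
    generalize commonNbrCount G x u w₂ = c3 at *
    generalize commonNbrCount G x v w₁ = c4 at *
    generalize commonNbrCount G x v w₂ = c5 at *
    generalize commonNbrCount G x w₁ w₂ = c6 at *
    have : (c1 = 24 ∧ c2 = 26 ∧ c3 = 26 ∧ c4 = 26 ∧ c5 = 26 ∧ c6 = 26) ∨
        (c1 = 25 ∧ c2 = 25 ∧ c3 = 26 ∧ c4 = 26 ∧ c5 = 26 ∧ c6 = 26) ∨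
        (c1 = 25 ∧ c2 = 26 ∧ c3 = 25 ∧ c4 = 26 ∧ c5 = 26 ∧ c6 = 26) ∨
        (c1 = 25 ∧ c2 = 26 ∧ c3 = 26 ∧ c4 = 25 ∧ c5 = 26 ∧ c6 = 26) ∨
        (c1 = 25 ∧ c2 = 26 ∧ c3 = 26 ∧ c4 = 26 ∧ c5 = 25 ∧ c6 = 26) ∨
        (c1 = 25 ∧ c2 = 26 ∧ c3 = 26 ∧ c4 = 26 ∧ c5 = 26 ∧ c6 = 25) := by
      omega
    rcases this with h | h | h | h | h | h <;>
      obtain ⟨rfl, rfl, rfl, rfl, rfl, rfl⟩ := h <;> decide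
  · let e (w a : V) : ℤ := if G.Adj w a then 1 else 0
    let f (w : V) : ℤ := 1 - (e w u + e w v + e w w₁ + e w w₂) +
      (e w u * e w v + e w u * e w w₁ + e w u * e w w₂ +
        e w v * e w w₁ + e w v * e w w₂ + e w w₁ * e w w₂)
    have f_nonneg : ∀ w, 0 ≤ f w := by
      intro w
      simp only [f, e]
      split_ifs <;> norm_num
    have deg : ∀ a ∈ ({u, v, w₁, w₂} : Finset V), ∑ w ∈ G.neighborFinset x, e w a = 105 := by
      intro a ha
      simp only [e]
      rw [sum_adj_eq_card_inter, h.card_inter_neighborFinset_of_adj (hUx a ha)]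
      rfl
    have total : ∑ w ∈ G.neighborFinset x, f w = 4 := by
      simp only [f, Finset.sum_add_distrib, Finset.sum_sub_distrib]
      rw [deg u (by simp), deg v (by simp), deg w₁ (by simp), deg w₂ (by simp)]
      simp only [e, sum_adj_mul_adj_eq_commonNbrCount, Finset.sum_const,
        G.card_neighborFinset_eq_degree, h.regular.degree_eq]
      norm_num
      omega
    have on_U : ∑ w ∈ ({u, v, w₁, w₂} : Finset V), f w = 4 := by
      have f_one : ∀ w ∈ ({u, v, w₁, w₂} : Finset V), f w = 1 := by
        intro w hw
        have e_zero : ∀ a ∈ ({u, v, w₁, w₂} : Finset V), e w a = 0 := by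
          intro a ha
          refine if_neg fun hwa => ?_
          exact hUind w hw a ha hwa.ne hwa
        simp [f, e_zero u, e_zero v, e_zero w₁, e_zero w₂]
      rw [Finset.sum_congr rfl f_one, Finset.sum_const, hUcard]
      rfl
    have hsub : ({u, v, w₁, w₂} : Finset V) ⊆ G.neighborFinset x := fun w hw => by
      simpa using hUx w hw
    have rest : ∑ w ∈ G.neighborFinset x \ {u, v, w₁, w₂}, f w = 0 := by
      have := Finset.sum_sdiff (f := f) hsub
      omega
    intro w hw
    have fw := (Finset.sum_eq_zero_iff_of_nonneg fun w _ => f_nonneg w).1 rest w hw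
    have card_eq : ((({u, v, w₁, w₂} : Finset V).filter fun z => G.Adj w z).card : ℤ) =
        e w u + e w v + e w w₁ + e w w₂ := by
      rw [← Finset.sum_boole, Finset.sum_insert (by grind), Finset.sum_insert (by grind),
        Finset.sum_pair hww]
      ring
    have : e w u + e w v + e w w₁ + e w w₂ ≤ 2 := by
      revert fw
      simp only [f, e]
      split_ifs <;> norm_num
    omega
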